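/- There exists a constant C > 0 such that the following holds for every n ≥ 2, every connected initial graph G₀ on n vertices, and every vertex u. Let T = ⌈C·n·ln n⌉. Then the probability (over the trajectory of the two-hop walk process started at G₀) of the event that both |N_T²(u)| ≥ δ₀/4 and d_T(u) < min{(1 + 1/8)·δ₀, n − 1}, is at most 1/n². -/

import Mathlib

open scoped Classical

noncomputable section

variable {V : Type} [Fintype V] [DecidableEq V]

/-- The neighbors of `v` in `G`, as a `Finset`. -/
def nbr (G : SimpleGraph V) (v : V) : Finset V := Finset.univ.filter (fun w => G.Adj v w)

/-- The degree `d(v)` of `v` in `G`. -/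
def deg (G : SimpleGraph V) (v : V) : ℕ := (nbr G v).card

/-- The minimum degree of `G`. -/
def minDeg (G : SimpleGraph V) : ℕ := sInf (Set.range (deg G))

/-- `Nk G u i` is the set `Nⁱ(u)` of vertices at graph distance exactly `i` from `u`. -/
def Nk (G : SimpleGraph V) (u : V) (i : ℕ) : Finset V :=
  Finset.univ.filter (fun v => v ≠ u ∧ G.dist u v = i)

/-- `degIn G v S` is `d(v, S)`, the number of neighbors of `v` lying in `S`. -/
def degIn (G : SimpleGraph V) (v : V) (S : Finset V) : ℕ := (nbr G v ∩ S).card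

/-- The graph obtained from a choice function `c` in one round of the triangulation
process: every vertex `w` adds the edge joining the ordered pair `c w` of its chosen
neighbors (edges are unordered, loops are discarded, all additions are simultaneous). -/
def triNext (G : SimpleGraph V) (c : V → V × V) : SimpleGraph V :=
  G ⊔ SimpleGraph.fromEdgeSet {e | ∃ v : V, e = s((c v).1, (c v).2)}

/-- The probability that in one round of the triangulation process on the current
graph `G` the vertices make exactly the choices recorded by `c`: each vertex with at
least one neighbor independently picks an ordered pair of its neighbors uniformly at
random with replacement; isolated vertices are given the dummy choice `(v, v)`. -/
def triWeight (G : SimpleGraph V) (c : V → V × V) : ℝ :=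
  ∏ v : V,
    if deg G v = 0 then (if c v = (v, v) then 1 else 0)
    else if (c v).1 ∈ nbr G v ∧ (c v).2 ∈ nbr G v then (1 : ℝ) / (deg G v : ℝ) ^ 2 else 0

/-- Transition probability of one round of the triangulation process. -/
def triStep (G G' : SimpleGraph V) : ℝ :=
  ∑ c : V → V × V, if triNext G c = G' then triWeight G c else 0

/-- The graph obtained from a choice function `c` in one round of the two-hop walk
process: every vertex `u` adds the edge to the endpoint `(c u).2` of its two-hop walk
(loops are discarded, all additions are simultaneous). -/
def hopNext (G : SimpleGraph V) (c : V → V × V) : SimpleGraph V :=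
  G ⊔ SimpleGraph.fromEdgeSet {e | ∃ u : V, e = s(u, (c u).2)}

/-- The probability that in one round of the two-hop walk process on the current graph
`G` the vertices make exactly the choices recorded by `c`: each vertex `u` with at
least one neighbor independently picks a uniformly random neighbor `v = (c u).1` and
then a uniformly random neighbor `w = (c u).2` of `v`; isolated vertices are given the
dummy choice `(u, u)`. -/
def hopWeight (G : SimpleGraph V) (c : V → V × V) : ℝ :=
  ∏ u : V,
    if deg G u = 0 then (if c u = (u, u) then 1 else 0)
    else if (c u).1 ∈ nbr G u ∧ (c u).2 ∈ nbr G (c u).1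
      then (1 : ℝ) / ((deg G u : ℝ) * (deg G (c u).1 : ℝ)) else 0

/-- Transition probability of one round of the two-hop walk process. -/
def hopStep (G G' : SimpleGraph V) : ℝ :=
  ∑ c : V → V × V, if hopNext G c = G' then hopWeight G c else 0

/-- `trajProb step g0 T E` is the probability, for the Markov chain on a finite state
space `Γ` with one-step transition probabilities `step` started at `g0`, that the
trajectory `(g_0, g_1, …, g_T)` satisfies the event `E`; probabilities are realized as
a probability mass function on finite sequences of states.  (The trajectory is passed
to `E` as a function on `ℕ`, frozen at time `T`.) -/
def trajProb {Γ : Type} [Fintype Γ] (step : Γ → Γ → ℝ) (g0 : Γ) (T : ℕ)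
    (E : (ℕ → Γ) → Prop) : ℝ :=
  ∑ s : Fin (T + 1) → Γ,
    if s 0 = g0 ∧ E (fun t => s ⟨min t T, Nat.lt_succ_of_le (Nat.min_le_right t T)⟩)
    then ∏ t : Fin T, step (s t.castSucc) (s t.succ) else 0

end

theorem trajProb_succ {Γ : Type} [Fintype Γ] (step : Γ → Γ → ℝ) (g : Γ) (T : ℕ) (Q : Γ → Prop) :
    trajProb step g (T + 1) (fun s => Q (s (T + 1))) =
      ∑ g', step g g' * trajProb step g' T (fun s => Q (s T)) := by
  unfold trajProb
  rw [← (Fin.consEquiv (fun _ : Fin (T + 2) => Γ)).sum_comp, Fintype.sum_prod_type]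
  simp only [Finset.mul_sum]
  rw [Finset.sum_comm, Finset.sum_comm (γ := Γ)]
  refine Finset.sum_congr rfl fun s _ => ?_
  have hmin : ∀ h, (⟨min (T + 1) (T + 1), h⟩ : Fin (T + 2)) = (Fin.last T).succ := by
    intro h; ext; simp
  have hmin' : ∀ h, (⟨min T T, h⟩ : Fin (T + 1)) = Fin.last T := by
    intro h; ext; simp
  simp only [hmin, hmin', Fin.consEquiv_apply, Fin.cons_zero, Fin.cons_succ, Fin.prod_univ_succ,
    Fin.castSucc_zero, Fin.castSucc_succ]
  by_cases hQ : Q (s (Fin.last T)) <;> simp [hQ]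

theorem trajProb_le_of_contracting {Γ : Type} [Fintype Γ] {step : Γ → Γ → ℝ}
    (hstep : ∀ g g', 0 ≤ step g g') (I : Set Γ)
    (hI : ∀ g ∈ I, ∀ g', step g g' ≠ 0 → g' ∈ I) {Ψ : Γ → ℝ} (hΨ0 : ∀ g, 0 ≤ Ψ g) {ρ : ℝ}
    (hρ : 0 ≤ ρ) (hΨ : ∀ g ∈ I, ∑ g', step g g' * Ψ g' ≤ ρ * Ψ g) {Q : Γ → Prop}
    (hQ : ∀ g ∈ I, Q g → 1 ≤ Ψ g) (T : ℕ) :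
    ∀ g ∈ I, trajProb step g T (fun s => Q (s T)) ≤ ρ ^ T * Ψ g := by
  induction T with
  | zero =>
    intro g hg
    unfold trajProb
    rw [← (Equiv.funUnique (Fin 1) Γ).symm.sum_comp]
    have : ∀ x : Γ, (if x = g ∧ Q x then (1 : ℝ) else 0) =
        if x = g then (if Q g then 1 else 0) else 0 := by
      intro x
      by_cases h : x = g <;> simp [h]
    simp [this]
    split_ifs with h
    · exact hQ g hg h
    · exact hΨ0 g
  | succ T ih =>
    intro g hg
    rw [trajProb_succ]
    calc _ ≤ ∑ g', step g g' * (ρ ^ T * Ψ g') := by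
            refine Finset.sum_le_sum fun g' _ => ?_
            by_cases h : step g g' = 0
            · simp [h]
            · exact mul_le_mul_of_nonneg_left (ih g' (hI g hg g' h)) (hstep g g')
      _ = ρ ^ T * ∑ g', step g g' * Ψ g' := by
            rw [Finset.mul_sum]; exact Finset.sum_congr rfl fun _ _ => by ring
      _ ≤ ρ ^ T * (ρ * Ψ g) := by gcongr; exact hΨ g hg
      _ = _ := by ring

theorem sum_hopStep_mul {V : Type} [Fintype V] [DecidableEq V] (G : SimpleGraph V)
    (f : SimpleGraph V → ℝ) :
    ∑ G', hopStep G G' * f G' = ∑ c, hopWeight G c * f (hopNext G c) := by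
  simp only [hopStep, Finset.sum_mul]
  rw [Finset.sum_comm]
  refine Finset.sum_congr rfl fun c _ => ?_
  simp [ite_mul]

theorem le_hopNext {V : Type} (G : SimpleGraph V) (c : V → V × V) : G ≤ hopNext G c :=
  le_sup_left

theorem hopNext_adj {V : Type} (G : SimpleGraph V) {c : V → V × V} {x y : V} (hxy : x ≠ y)
    (h : (c x).2 = y) : (hopNext G c).Adj x y :=
  Or.inr ⟨⟨x, by rw [h]⟩, hxy⟩

/-- The probability that one vertex `x` makes the choice `p`. -/
noncomputable def hopChoice {V : Type} [Fintype V] (G : SimpleGraph V) (x : V) (p : V × V) : ℝ :=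
  if p.1 ∈ nbr G x ∧ p.2 ∈ nbr G p.1 then (1 : ℝ) / ((deg G x : ℝ) * (deg G p.1 : ℝ)) else 0

/-- The probability that the two-hop walk from `x` ends in `S`. -/
noncomputable def hopHit {V : Type} [Fintype V] [DecidableEq V] (G : SimpleGraph V) (x : V)
    (S : Finset V) : ℝ :=
  ∑ v ∈ nbr G x, ((nbr G v ∩ S).card : ℝ) / ((deg G x : ℝ) * (deg G v : ℝ))

section

variable {V : Type} [Fintype V] [DecidableEq V] {G : SimpleGraph V}

theorem hopWeight_eq_prod (hG : ∀ x, deg G x ≠ 0) (c : V → V × V) :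
    hopWeight G c = ∏ x, hopChoice G x (c x) := by
  simp [hopWeight, hopChoice, hG]

theorem hopChoice_nonneg (x : V) (p : V × V) : 0 ≤ hopChoice G x p := by
  unfold hopChoice; split_ifs <;> positivity

theorem hopWeight_nonneg (G : SimpleGraph V) (c : V → V × V) : 0 ≤ hopWeight G c := by
  unfold hopWeight
  refine Finset.prod_nonneg fun x _ => ?_
  split_ifs <;> positivity

theorem hopStep_nonneg (G G' : SimpleGraph V) : 0 ≤ hopStep G G' := by
  unfold hopStep
  refine Finset.sum_nonneg fun c _ => ?_
  split_ifs
  · exact hopWeight_nonneg G c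
  · exact le_rfl

theorem le_of_hopStep_ne_zero {G' : SimpleGraph V} (h : hopStep G G' ≠ 0) : G ≤ G' := by
  obtain ⟨c, -, hc⟩ := Finset.exists_ne_zero_of_sum_ne_zero h
  have : hopNext G c = G' := by
    by_contra hne
    simp [hne] at hc
  exact this ▸ le_hopNext G c

theorem sum_hopChoice_mem (x : V) (S : Finset V) :
    ∑ p : V × V, (if p.2 ∈ S then hopChoice G x p else 0) = hopHit G x S := by
  rw [Fintype.sum_prod_type]
  unfold hopHit
  rw [← Finset.sum_filter_add_sum_filter_not Finset.univ (· ∈ nbr G x)]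
  have h0 : ∑ v with v ∉ nbr G x, ∑ w, (if (v, w).2 ∈ S then hopChoice G x (v, w) else 0) = 0 := by
    refine Finset.sum_eq_zero fun v hv => Finset.sum_eq_zero fun w _ => ?_
    simp only [Finset.mem_filter, Finset.mem_univ, true_and] at hv
    simp [hopChoice, hv]
  rw [h0, add_zero]
  refine Finset.sum_congr (by ext; simp) fun v hv => ?_
  have : ∀ w, (if (v, w).2 ∈ S then hopChoice G x (v, w) else 0) =
      if w ∈ nbr G v ∩ S then (1 : ℝ) / ((deg G x : ℝ) * (deg G v : ℝ)) else 0 := by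
    intro w
    simp only [hopChoice, Finset.mem_inter]
    by_cases h1 : w ∈ S <;> by_cases h2 : w ∈ nbr G v <;> simp [h1, h2, hv]
  rw [Finset.sum_congr rfl fun w _ => this w, Finset.sum_ite_mem]
  simp [div_eq_mul_inv]

theorem hopHit_univ (hG : ∀ x, deg G x ≠ 0) (x : V) : hopHit G x Finset.univ = 1 := by
  unfold hopHit
  have : ∀ v ∈ nbr G x, ((nbr G v ∩ Finset.univ).card : ℝ) / ((deg G x : ℝ) * (deg G v : ℝ)) =
      1 / (deg G x : ℝ) := by
    intro v _
    have h1 : (deg G v : ℝ) ≠ 0 := by exact_mod_cast hG v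
    have h2 : (deg G x : ℝ) ≠ 0 := by exact_mod_cast hG x
    rw [Finset.inter_univ]
    change (deg G v : ℝ) / _ = _
    field_simp
  rw [Finset.sum_congr rfl this, Finset.sum_const, nsmul_eq_mul]
  have h2 : (deg G x : ℝ) ≠ 0 := by exact_mod_cast hG x
  change (deg G x : ℝ) * _ = 1
  field_simp

theorem sum_hopChoice (hG : ∀ x, deg G x ≠ 0) (x : V) : ∑ p, hopChoice G x p = 1 := by
  rw [← hopHit_univ hG x, ← sum_hopChoice_mem]
  simp

theorem sum_hopWeight (hG : ∀ x, deg G x ≠ 0) : ∑ c, hopWeight G c = 1 := by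
  simp only [hopWeight_eq_prod hG]
  rw [← Fintype.prod_sum]
  simp [sum_hopChoice hG]

/-- The probability that no walk from `X` ends in `S`. -/
theorem sum_hopWeight_avoid_le (hG : ∀ x, deg G x ≠ 0) (X S : Finset V) :
    ∑ c, (if ∃ x ∈ X, (c x).2 ∈ S then 0 else hopWeight G c) ≤
      Real.exp (-∑ x ∈ X, hopHit G x S) := by
  have key : ∀ c : V → V × V, (if ∃ x ∈ X, (c x).2 ∈ S then 0 else hopWeight G c) =
      ∏ x, (if x ∈ X ∧ (c x).2 ∈ S then 0 else hopChoice G x (c x)) := by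
    intro c
    split_ifs with h
    · obtain ⟨x, hx, hxS⟩ := h
      exact (Finset.prod_eq_zero (Finset.mem_univ x) (by simp [hx, hxS])).symm
    · rw [hopWeight_eq_prod hG]
      refine Finset.prod_congr rfl fun x _ => ?_
      rw [if_neg fun hx => h ⟨x, hx⟩]
  simp only [key]
  rw [← Fintype.prod_sum
    (f := fun x p => if x ∈ X ∧ p.2 ∈ S then (0 : ℝ) else hopChoice G x p)]
  have hle : ∀ x, ∑ p : V × V, (if x ∈ X ∧ p.2 ∈ S then (0 : ℝ) else hopChoice G x p) ≤
      if x ∈ X then Real.exp (-hopHit G x S) else 1 := by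
    intro x
    by_cases hx : x ∈ X
    · simp only [hx, true_and, if_true]
      have : ∑ p : V × V, (if p.2 ∈ S then (0 : ℝ) else hopChoice G x p) = 1 - hopHit G x S := by
        rw [← sum_hopChoice_mem, ← sum_hopChoice hG x, ← Finset.sum_sub_distrib]
        refine Finset.sum_congr rfl fun p _ => ?_
        split_ifs <;> simp
      rw [this]
      exact Real.one_sub_le_exp_neg _
    · simp [hx, sum_hopChoice hG]
  refine (Finset.prod_le_prod (fun x _ => Finset.sum_nonneg fun p _ => ?_)
    fun x _ => hle x).trans ?_
  · split_ifs
    · exact le_rfl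
    · exact hopChoice_nonneg x p
  · rw [Finset.prod_ite_mem, Finset.univ_inter, ← Real.exp_sum, Finset.sum_neg_distrib]

/-- If `f` never increases in a round and shrinks by the factor `1 - η` whenever a walk from `X`
ends in `S`, then its expectation shrinks accordingly. -/
theorem sum_hopStep_mul_le (hG : ∀ x, deg G x ≠ 0) {f : SimpleGraph V → ℝ} (hf : 0 ≤ f G)
    (X S : Finset V) {s η : ℝ} (hs0 : 0 ≤ s) (hs1 : s ≤ 1) (hη : 0 ≤ η)
    (hs : s ≤ ∑ x ∈ X, hopHit G x S) (hmono : ∀ c, f (hopNext G c) ≤ f G)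
    (hdrop : ∀ c : V → V × V, (∃ x ∈ X, (c x).2 ∈ S) → f (hopNext G c) ≤ (1 - η) * f G) :
    ∑ G', hopStep G G' * f G' ≤ (1 - s / 2 * η) * f G := by
  rw [sum_hopStep_mul]
  set p := ∑ c, (if ∃ x ∈ X, (c x).2 ∈ S then 0 else hopWeight G c) with hp
  have hpe : p ≤ 1 - s / 2 := by
    have h1 : p ≤ Real.exp (-s) :=
      (sum_hopWeight_avoid_le hG X S).trans (Real.exp_le_exp.2 (by linarith))
    have h2 : Real.exp (-s) ≤ 1 / (1 + s) := by
      rw [Real.exp_neg, ← one_div]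
      exact one_div_le_one_div_of_le (by linarith) (by linarith [Real.add_one_le_exp s])
    have h3 : 1 / (1 + s) ≤ 1 - s / 2 := by
      rw [div_le_iff₀ (by linarith)]
      nlinarith
    linarith
  calc ∑ c, hopWeight G c * f (hopNext G c)
      ≤ ∑ c, ((1 - η) * f G * hopWeight G c +
          η * f G * (if ∃ x ∈ X, (c x).2 ∈ S then 0 else hopWeight G c)) := by
        refine Finset.sum_le_sum fun c _ => ?_
        have hw := hopWeight_nonneg G c
        split_ifs with h
        · nlinarith [mul_le_mul_of_nonneg_left (hdrop c h) hw]
        · nlinarith [mul_le_mul_of_nonneg_left (hmono c) hw]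
    _ = (1 - η) * f G + η * f G * p := by
        rw [Finset.sum_add_distrib, ← Finset.mul_sum, ← Finset.mul_sum, sum_hopWeight hG, mul_one]
    _ ≤ (1 - s / 2 * η) * f G := by
        nlinarith [mul_le_mul_of_nonneg_left hpe (mul_nonneg hη hf)]

end

section

variable {V : Type} [Fintype V] {G G' : SimpleGraph V}

theorem mem_nbr {v w : V} : w ∈ nbr G v ↔ G.Adj v w := by simp [nbr]

theorem nbr_mono (h : G ≤ G') (v : V) : nbr G v ⊆ nbr G' v := fun _ hw =>
  mem_nbr.2 (h (mem_nbr.1 hw))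

theorem deg_mono (h : G ≤ G') (v : V) : deg G v ≤ deg G' v := Finset.card_le_card (nbr_mono h v)

theorem deg_le_card (G : SimpleGraph V) (v : V) : deg G v + 1 ≤ Fintype.card V := by
  have : nbr G v ⊂ Finset.univ :=
    Finset.ssubset_univ_iff.2 fun h => G.loopless.irrefl v (mem_nbr.1 (h ▸ Finset.mem_univ v))
  exact Finset.card_lt_card this

end

noncomputable section

variable {V : Type} [Fintype V] [DecidableEq V]

/-- The closed neighborhood of `u`. -/
def closedNbr (G : SimpleGraph V) (u : V) : Finset V := insert u (nbr G u)

/-- The vertices of the closed neighborhood of `u` having at least `δ / 4` neighbors in it. -/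
def core (G : SimpleGraph V) (u : V) (δ : ℕ) : Finset V :=
  (closedNbr G u).filter fun x => δ ≤ 4 * (nbr G x ∩ closedNbr G u).card

/-- The number of neighbors of `p` in the core around `u`. -/
def tie (G : SimpleGraph V) (u : V) (δ : ℕ) (p : V) : ℕ := (nbr G p ∩ core G u δ).card

/-- The contribution of the vertex `p` to the reciprocal of the potential. -/
def tieFactor (G : SimpleGraph V) (u : V) (δ : ℕ) (p : V) : ℕ :=
  (tie G u δ p + 1) * if p ∈ closedNbr G u then 2 else 1

/-- The reciprocal of the potential of the vertex set `P`. -/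
def potDen (G : SimpleGraph V) (u : V) (δ : ℕ) (P : Finset V) : ℕ :=
  (deg G u + 1) * ∏ p ∈ P, tieFactor G u δ p

/-- The potential of the target `y`, which vanishes once `y` is linked to `u` or `u` has degree at
least `9 δ / 8`. -/
def pot (u : V) (δ : ℕ) (P : Finset V) (y : V) (G : SimpleGraph V) : ℝ :=
  if y ∈ closedNbr G u ∨ 9 * δ ≤ 8 * deg G u then 0 else (potDen G u δ P : ℝ)⁻¹

/-- The exceptional vertices of the closed neighborhood of `u`: those outside the core and those
of degree above `9 δ / 4`. -/
def exceptional (G : SimpleGraph V) (u : V) (δ : ℕ) : Finset V :=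
  (closedNbr G u).filter fun x => x ∉ core G u δ ∨ 9 * δ < 4 * deg G x

variable {G G' : SimpleGraph V} {u y p : V} {δ n : ℕ} {P : Finset V}

theorem closedNbr_mono (h : G ≤ G') (v : V) : closedNbr G v ⊆ closedNbr G' v :=
  Finset.insert_subset_insert _ (nbr_mono h v)

theorem core_mono (h : G ≤ G') (u : V) (δ : ℕ) : core G u δ ⊆ core G' u δ := by
  intro x hx
  simp only [core, Finset.mem_filter] at hx ⊢
  exact ⟨closedNbr_mono h u hx.1, hx.2.trans (Nat.mul_le_mul_left _ (Finset.card_le_card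
    (Finset.inter_subset_inter (nbr_mono h x) (closedNbr_mono h u))))⟩

theorem tie_mono (h : G ≤ G') (u : V) (δ : ℕ) (p : V) : tie G u δ p ≤ tie G' u δ p :=
  Finset.card_le_card (Finset.inter_subset_inter (nbr_mono h p) (core_mono h u δ))

theorem tieFactor_mono (h : G ≤ G') (u : V) (δ : ℕ) (p : V) :
    tieFactor G u δ p ≤ tieFactor G' u δ p := by
  unfold tieFactor
  refine Nat.mul_le_mul (Nat.succ_le_succ (tie_mono h u δ p)) ?_
  have := @closedNbr_mono _ _ _ _ _ h u p
  by_cases h1 : p ∈ closedNbr G u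
  · simp [h1, this h1]
  · split_ifs <;> simp

theorem tieFactor_pos (G : SimpleGraph V) (u : V) (δ : ℕ) (p : V) : 0 < tieFactor G u δ p := by
  unfold tieFactor; split_ifs <;> positivity

theorem potDen_pos (G : SimpleGraph V) (u : V) (δ : ℕ) (P : Finset V) : 0 < potDen G u δ P :=
  Nat.mul_pos (Nat.succ_pos _) (Finset.prod_pos fun p _ => tieFactor_pos G u δ p)

theorem potDen_mono (h : G ≤ G') (u : V) (δ : ℕ) (P : Finset V) :
    potDen G u δ P ≤ potDen G' u δ P :=
  Nat.mul_le_mul (Nat.succ_le_succ (deg_mono h u))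
    (Finset.prod_le_prod' fun p _ => tieFactor_mono h u δ p)

theorem potDen_of_deg_lt (h : G ≤ G') (hd : deg G u < deg G' u) :
    potDen G u δ P * (deg G u + 2) ≤ potDen G' u δ P * (deg G u + 1) := by
  unfold potDen
  have h1 : ∏ p ∈ P, tieFactor G u δ p ≤ ∏ p ∈ P, tieFactor G' u δ p :=
    Finset.prod_le_prod' fun p _ => tieFactor_mono h u δ p
  have h2 : deg G u + 2 ≤ deg G' u + 1 := by omega
  calc _ = (deg G u + 2) * (∏ p ∈ P, tieFactor G u δ p) * (deg G u + 1) := by ring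
    _ ≤ _ := by gcongr

theorem potDen_of_tieFactor (h : G ≤ G') (hp : p ∈ P) {k : ℕ}
    (hk : tieFactor G u δ p * (k + 2) ≤ tieFactor G' u δ p * (k + 1)) :
    potDen G u δ P * (k + 2) ≤ potDen G' u δ P * (k + 1) := by
  unfold potDen
  have h1 : ∏ p ∈ P.erase p, tieFactor G u δ p ≤ ∏ p ∈ P.erase p, tieFactor G' u δ p :=
    Finset.prod_le_prod' fun p _ => tieFactor_mono h u δ p
  rw [← Finset.mul_prod_erase P _ hp, ← Finset.mul_prod_erase P _ hp]
  calc _ = (deg G u + 1) * ((tieFactor G u δ p * (k + 2)) *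
            ∏ p ∈ P.erase p, tieFactor G u δ p) := by ring
    _ ≤ (deg G' u + 1) * ((tieFactor G' u δ p * (k + 1)) *
            ∏ p ∈ P.erase p, tieFactor G' u δ p) := by
          have := deg_mono h u
          gcongr
    _ = _ := by ring

theorem potDen_of_tie_lt (h : G ≤ G') (hp : p ∈ P) (ht : tie G u δ p < tie G' u δ p) :
    potDen G u δ P * (tie G u δ p + 2) ≤ potDen G' u δ P * (tie G u δ p + 1) := by
  refine potDen_of_tieFactor h hp ?_
  unfold tieFactor
  have h2 : (if p ∈ closedNbr G u then 2 else 1) ≤ if p ∈ closedNbr G' u then 2 else 1 := by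
    have := @closedNbr_mono _ _ _ _ _ h u p
    by_cases h1 : p ∈ closedNbr G u
    · simp [h1, this h1]
    · split_ifs <;> simp
  have h3 : tie G u δ p + 2 ≤ tie G' u δ p + 1 := by omega
  calc _ = (tie G u δ p + 2) * (if p ∈ closedNbr G u then 2 else 1) * (tie G u δ p + 1) := by ring
    _ ≤ _ := by gcongr

theorem potDen_of_linked (h : G ≤ G') (hp : p ∈ P) (h1 : p ∉ closedNbr G u)
    (h2 : p ∈ closedNbr G' u) : potDen G u δ P * (0 + 2) ≤ potDen G' u δ P * (0 + 1) := by
  refine potDen_of_tieFactor h hp ?_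
  have := tie_mono h u δ p
  simp only [tieFactor, h1, h2, if_true, if_false]
  omega

theorem pot_nonneg (u : V) (δ : ℕ) (P : Finset V) (y : V) (G : SimpleGraph V) :
    0 ≤ pot u δ P y G := by
  unfold pot; split_ifs <;> positivity

theorem pot_of_done (h : y ∈ closedNbr G u ∨ 9 * δ ≤ 8 * deg G u) : pot u δ P y G = 0 := if_pos h

theorem done_mono (h : G ≤ G') (hy : y ∈ closedNbr G u ∨ 9 * δ ≤ 8 * deg G u) :
    y ∈ closedNbr G' u ∨ 9 * δ ≤ 8 * deg G' u :=
  hy.imp (fun h1 => closedNbr_mono h u h1) fun h1 => h1.trans (Nat.mul_le_mul_left _ (deg_mono h u))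

theorem pot_anti (h : G ≤ G') : pot u δ P y G' ≤ pot u δ P y G := by
  by_cases h1 : y ∈ closedNbr G' u ∨ 9 * δ ≤ 8 * deg G' u
  · rw [pot_of_done h1]; exact pot_nonneg ..
  · rw [pot, if_neg h1, pot, if_neg fun h2 => h1 (done_mono h h2)]
    have := potDen_pos G u δ P
    have := potDen_mono h u δ P
    gcongr

theorem pot_drop (h : G ≤ G') {k : ℕ}
    (hk : potDen G u δ P * (k + 2) ≤ potDen G' u δ P * (k + 1)) :
    pot u δ P y G' ≤ (1 - 1 / ((k : ℝ) + 2)) * pot u δ P y G := by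
  by_cases h1 : y ∈ closedNbr G' u ∨ 9 * δ ≤ 8 * deg G' u
  · rw [pot_of_done h1]
    refine mul_nonneg ?_ (pot_nonneg ..)
    rw [sub_nonneg, div_le_one (by positivity)]
    linarith [(Nat.cast_nonneg k : (0 : ℝ) ≤ k)]
  · rw [pot, if_neg h1, pot, if_neg fun h2 => h1 (done_mono h h2)]
    have a1 : (0 : ℝ) < potDen G u δ P := by exact_mod_cast potDen_pos G u δ P
    have a2 : (0 : ℝ) < potDen G' u δ P := by exact_mod_cast potDen_pos G' u δ P
    have hk' : (potDen G u δ P : ℝ) * (k + 2) ≤ potDen G' u δ P * (k + 1) := by exact_mod_cast hk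
    have : (1 : ℝ) - 1 / ((k : ℝ) + 2) = (k + 1) / (k + 2) := by field_simp; ring
    rw [this, ← one_div, ← div_eq_mul_inv, div_div, div_le_div_iff₀ a2 (by positivity)]
    linarith

theorem card_nbr_inter_closedNbr_le {v : V} (hv : v ∈ closedNbr G u) :
    (nbr G v ∩ closedNbr G u).card ≤ deg G u := by
  have h1 : nbr G v ∩ closedNbr G u ⊆ (closedNbr G u).erase v := by
    intro x hx
    rw [Finset.mem_inter] at hx
    exact Finset.mem_erase.2 ⟨(mem_nbr.1 hx.1).ne', hx.2⟩
  have h2 := Finset.card_le_card h1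
  rw [Finset.card_erase_of_mem hv] at h2
  have h3 := Finset.card_insert_le u (nbr G u)
  change (closedNbr G u).card ≤ deg G u + 1 at h3
  omega

theorem self_mem_core (hδ : ∀ x, δ ≤ deg G x) : u ∈ core G u δ := by
  have : nbr G u ∩ closedNbr G u = nbr G u :=
    Finset.inter_eq_left.2 (Finset.subset_insert _ _)
  rw [core, Finset.mem_filter, this]
  refine ⟨Finset.mem_insert_self _ _, ?_⟩
  have := hδ u
  change δ ≤ 4 * deg G u
  omega

/-- An exceptional vertex sends at least half of its edges out of the closed neighborhood. -/
theorem exceptional_spec (hδ : ∀ x, δ ≤ deg G x) (hd : 8 * deg G u < 9 * δ) {v : V}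
    (hv : v ∈ exceptional G u δ) :
    v ∈ nbr G u ∧ deg G v ≤ 2 * (nbr G v ∩ (closedNbr G u)ᶜ).card := by
  simp only [exceptional, Finset.mem_filter] at hv
  obtain ⟨hvc, hv⟩ := hv
  constructor
  · rcases Finset.mem_insert.1 hvc with rfl | h
    · rcases hv with h1 | h1
      · exact absurd (self_mem_core hδ) h1
      · omega
    · exact h
  · have h1 : (nbr G v ∩ closedNbr G u).card + (nbr G v ∩ (closedNbr G u)ᶜ).card = deg G v := by
      rw [← Finset.sdiff_eq_inter_compl]
      exact Finset.card_inter_add_card_sdiff _ _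
    have h2 := card_nbr_inter_closedNbr_le hvc
    have h3 := hδ v
    rcases hv with h4 | h4
    · simp only [core, Finset.mem_filter, hvc, true_and, not_le] at h4
      omega
    · omega

theorem pot_contract_of_exceptional (hn : Fintype.card V = n) (hδ0 : 0 < δ)
    (hδ : ∀ x, δ ≤ deg G x) (hd : 8 * deg G u < 9 * δ)
    (hE : δ ≤ 32 * (exceptional G u δ).card) :
    ∑ G', hopStep G G' * pot u δ P y G' ≤ (1 - 1 / (432 * n)) * pot u δ P y G := by
  have hG : ∀ x, deg G x ≠ 0 := fun x => (hδ0.trans_le (hδ x)).ne'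
  have hD : deg G u + 1 ≤ n := hn ▸ deg_le_card G u
  have hhit : (1 : ℝ) / 72 ≤ ∑ x ∈ {u}, hopHit G x (closedNbr G u)ᶜ := by
    rw [Finset.sum_singleton, hopHit]
    have hsub : exceptional G u δ ⊆ nbr G u := fun v hv => (exceptional_spec hδ hd hv).1
    calc (1 : ℝ) / 72 ≤ (exceptional G u δ).card * (1 / (2 * (deg G u : ℝ))) := by
          have h1 : (0 : ℝ) < deg G u := by exact_mod_cast Nat.pos_of_ne_zero (hG u)
          have h2 : (δ : ℝ) ≤ 32 * (exceptional G u δ).card := by exact_mod_cast hE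
          have h3 : (8 : ℝ) * deg G u < 9 * δ := by exact_mod_cast hd
          rw [mul_one_div, div_le_div_iff₀ (by norm_num) (by positivity)]
          linarith
      _ = ∑ v ∈ exceptional G u δ, 1 / (2 * (deg G u : ℝ)) := by simp
      _ ≤ ∑ v ∈ exceptional G u δ,
            ((nbr G v ∩ (closedNbr G u)ᶜ).card : ℝ) / ((deg G u : ℝ) * (deg G v : ℝ)) := by
          refine Finset.sum_le_sum fun v hv => ?_
          have h1 : (0 : ℝ) < deg G u := by exact_mod_cast Nat.pos_of_ne_zero (hG u)
          have h2 : (0 : ℝ) < deg G v := by exact_mod_cast Nat.pos_of_ne_zero (hG v)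
          have h3 : (deg G v : ℝ) ≤ 2 * (nbr G v ∩ (closedNbr G u)ᶜ).card := by
            exact_mod_cast (exceptional_spec hδ hd hv).2
          rw [div_le_div_iff₀ (by positivity) (by positivity)]
          nlinarith
      _ ≤ _ := Finset.sum_le_sum_of_subset_of_nonneg hsub fun _ _ _ => by positivity
  refine (sum_hopStep_mul_le hG (pot_nonneg ..) {u} (closedNbr G u)ᶜ (by norm_num) (by norm_num)
    (η := 1 / ((deg G u : ℝ) + 2)) (by positivity) hhit (fun c => pot_anti (le_hopNext G c))
    fun c hc => ?_).trans ?_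
  · obtain ⟨x, hx, hxS⟩ := hc
    rw [Finset.mem_singleton] at hx
    subst hx
    refine pot_drop (le_hopNext G c) (potDen_of_deg_lt (le_hopNext G c) ?_)
    rw [Finset.mem_compl, closedNbr, Finset.mem_insert, not_or] at hxS
    refine Finset.card_lt_card ((Finset.ssubset_iff_of_subset (nbr_mono (le_hopNext G c) x)).2
      ⟨(c x).2, mem_nbr.2 (hopNext_adj G (Ne.symm hxS.1) rfl), hxS.2⟩)
  · refine mul_le_mul_of_nonneg_right ?_ (pot_nonneg ..)
    have h1 : (deg G u : ℝ) + 1 ≤ n := by exact_mod_cast hD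
    have h2 : (0 : ℝ) ≤ deg G u := by positivity
    have : (1 : ℝ) / (432 * n) ≤ 1 / 72 / 2 * (1 / ((deg G u : ℝ) + 2)) := by
      rw [div_div, ← mul_comm (1 / _), div_mul_div_comm]
      apply div_le_div₀ <;> first | positivity | linarith
    linarith

theorem pot_contract_of_growth (hn : Fintype.card V = n) (hδ0 : 0 < δ)
    (hδ : ∀ x, δ ≤ deg G x) (hp : p ∈ P) {M : Finset V}
    (hM : M ⊆ nbr G p) (hMt : tie G u δ p + 2 ≤ 3 * M.card)
    (hMX : ∀ v ∈ M, δ ≤ 32 *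
      (nbr G v ∩ ((closedNbr G u \ exceptional G u δ) \ insert p (nbr G p))).card) :
    ∑ G', hopStep G G' * pot u δ P y G' ≤ (1 - 1 / (432 * n)) * pot u δ P y G := by
  set X := (closedNbr G u \ exceptional G u δ) \ insert p (nbr G p) with hX
  have hG : ∀ x, deg G x ≠ 0 := fun x => (hδ0.trans_le (hδ x)).ne'
  have hXs : ∀ x ∈ X, x ∈ core G u δ ∧ 4 * deg G x ≤ 9 * δ ∧ x ≠ p ∧ x ∉ nbr G p := by
    intro x hx
    simp only [hX, exceptional, Finset.mem_sdiff, Finset.mem_filter, not_and, not_or, not_not,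
      Finset.mem_insert, not_lt] at hx
    exact ⟨(hx.1.2 hx.1.1).1, (hx.1.2 hx.1.1).2, hx.2.1, hx.2.2⟩
  have hMn : M.card ≤ n := hn ▸ Finset.card_le_univ M
  have hn0 : 0 < n := by omega
  have hn0' : (0 : ℝ) < n := by exact_mod_cast hn0
  have hδ0' : (0 : ℝ) < δ := by exact_mod_cast hδ0
  have hhit : (M.card : ℝ) / (72 * n) ≤ ∑ x ∈ X, hopHit G x {p} := by
    calc (M.card : ℝ) / (72 * n) = ∑ v ∈ M, 1 / (72 * (n : ℝ)) := by
          simp [div_eq_mul_inv]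
      _ ≤ ∑ v ∈ M, ∑ x ∈ X,
            (if v ∈ nbr G x then 1 / ((deg G x : ℝ) * (deg G v : ℝ)) else 0) := by
          refine Finset.sum_le_sum fun v hv => ?_
          have hfil : X.filter (fun x => v ∈ nbr G x) = nbr G v ∩ X := by
            ext x
            simp only [Finset.mem_filter, Finset.mem_inter, mem_nbr, G.adj_comm x v]
            tauto
          rw [← Finset.sum_filter, hfil]
          calc (1 : ℝ) / (72 * n) ≤ (nbr G v ∩ X).card * (1 / (9 * δ / 4 * n)) := by
                have h1 : (δ : ℝ) ≤ 32 * (nbr G v ∩ X).card := by exact_mod_cast hMX v hv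
                rw [mul_one_div, div_le_div_iff₀ (by positivity) (by positivity)]
                nlinarith
            _ = ∑ x ∈ nbr G v ∩ X, (1 : ℝ) / (9 * δ / 4 * n) := by simp
            _ ≤ _ := by
                refine Finset.sum_le_sum fun x hx => ?_
                have h1 : (0 : ℝ) < deg G x := by exact_mod_cast Nat.pos_of_ne_zero (hG x)
                have h2 : (0 : ℝ) < deg G v := by exact_mod_cast Nat.pos_of_ne_zero (hG v)
                have h3 : (4 : ℝ) * deg G x ≤ 9 * δ := by
                  exact_mod_cast (hXs x (Finset.mem_inter.1 hx).2).2.1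
                have h4 : (deg G v : ℝ) + 1 ≤ n := by exact_mod_cast hn ▸ deg_le_card G v
                apply one_div_le_one_div_of_le (by positivity)
                apply mul_le_mul <;> first | positivity | linarith
      _ = ∑ x ∈ X, ∑ v ∈ M,
            (if v ∈ nbr G x then 1 / ((deg G x : ℝ) * (deg G v : ℝ)) else 0) := Finset.sum_comm
      _ ≤ _ := by
          refine Finset.sum_le_sum fun x _ => ?_
          rw [← Finset.sum_filter, hopHit]
          refine (Finset.sum_le_sum fun v hv => ?_).trans
            (Finset.sum_le_sum_of_subset_of_nonneg (s := M.filter (fun v => v ∈ nbr G x))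
              (fun v hv => (Finset.mem_filter.1 hv).2) fun _ _ _ => by positivity)
          have : nbr G v ∩ {p} = {p} := by
            rw [Finset.inter_eq_right, Finset.singleton_subset_iff]
            exact mem_nbr.2 (mem_nbr.1 (hM (Finset.mem_filter.1 hv).1)).symm
          simp [this]
  have hs1 : (M.card : ℝ) / (72 * n) ≤ 1 := by
    have : (M.card : ℝ) ≤ n := by exact_mod_cast hMn
    rw [div_le_one (by positivity)]
    linarith
  refine (sum_hopStep_mul_le hG (pot_nonneg ..) X {p} (by positivity) hs1
    (η := 1 / ((tie G u δ p : ℝ) + 2)) (by positivity) hhit (fun c => pot_anti (le_hopNext G c))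
    fun c hc => ?_).trans ?_
  · obtain ⟨x, hx, hxS⟩ := hc
    rw [Finset.mem_singleton] at hxS
    obtain ⟨h1, -, h2, h3⟩ := hXs x hx
    have hle := le_hopNext G c
    refine pot_drop hle (potDen_of_tie_lt hle hp ?_)
    refine Finset.card_lt_card ((Finset.ssubset_iff_of_subset
      (Finset.inter_subset_inter (nbr_mono hle p) (core_mono hle u δ))).2 ⟨x, ?_, ?_⟩)
    · exact Finset.mem_inter.2 ⟨mem_nbr.2 (hopNext_adj G h2 hxS).symm, core_mono hle u δ h1⟩
    · exact fun h => h3 (Finset.mem_inter.1 h).1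
  · refine mul_le_mul_of_nonneg_right ?_ (pot_nonneg ..)
    have h1 : (tie G u δ p : ℝ) + 2 ≤ 3 * M.card := by exact_mod_cast hMt
    have : (1 : ℝ) / (432 * n) ≤ (M.card : ℝ) / (72 * n) / 2 * (1 / ((tie G u δ p : ℝ) + 2)) := by
      rw [div_div, div_mul_div_comm, div_le_div_iff₀ (by positivity) (by positivity)]
      nlinarith
    linarith

theorem pot_contract_of_tie (hn : Fintype.card V = n) (hδ0 : 0 < δ)
    (hδ : ∀ x, δ ≤ deg G x) (hd : 8 * deg G u < 9 * δ) (hp : p ∈ P) (hpu : p ∉ closedNbr G u)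
    (ht : δ ≤ 16 * tie G u δ p) :
    ∑ G', hopStep G G' * pot u δ P y G' ≤ (1 - 1 / (432 * n)) * pot u δ P y G := by
  have hG : ∀ x, deg G x ≠ 0 := fun x => (hδ0.trans_le (hδ x)).ne'
  have hn0 : 0 < n := by have := hn ▸ deg_le_card G u; omega
  have hn0' : (0 : ℝ) < n := by exact_mod_cast hn0
  have hn1 : (1 : ℝ) ≤ n := by exact_mod_cast hn0
  rw [closedNbr, Finset.mem_insert, not_or] at hpu
  have hsub : nbr G p ∩ core G u δ ⊆ nbr G u := by
    intro x hx
    rw [Finset.mem_inter, core, Finset.mem_filter, closedNbr, Finset.mem_insert] at hx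
    rcases hx.2.1 with rfl | h
    · exact absurd (mem_nbr.2 (mem_nbr.1 hx.1).symm) hpu.2
    · exact h
  have hhit : (1 : ℝ) / (18 * n) ≤ ∑ x ∈ {u}, hopHit G x {p} := by
    rw [Finset.sum_singleton, hopHit]
    have h1 : (0 : ℝ) < deg G u := by exact_mod_cast Nat.pos_of_ne_zero (hG u)
    calc (1 : ℝ) / (18 * n) ≤ tie G u δ p * (1 / ((deg G u : ℝ) * n)) := by
          have h2 : (δ : ℝ) ≤ 16 * tie G u δ p := by exact_mod_cast ht
          have h3 : (8 : ℝ) * deg G u < 9 * δ := by exact_mod_cast hd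
          rw [mul_one_div, div_le_div_iff₀ (by positivity) (by positivity)]
          nlinarith
      _ = ∑ v ∈ nbr G p ∩ core G u δ, 1 / ((deg G u : ℝ) * n) := by simp [tie]
      _ ≤ ∑ v ∈ nbr G p ∩ core G u δ,
            ((nbr G v ∩ {p}).card : ℝ) / ((deg G u : ℝ) * (deg G v : ℝ)) := by
          refine Finset.sum_le_sum fun v hv => ?_
          have h2 : (0 : ℝ) < deg G v := by exact_mod_cast Nat.pos_of_ne_zero (hG v)
          have h4 : deg G v ≤ n := by have := hn ▸ deg_le_card G v; omega
          have : nbr G v ∩ {p} = {p} := by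
            rw [Finset.inter_eq_right, Finset.singleton_subset_iff]
            exact mem_nbr.2 (mem_nbr.1 (Finset.mem_inter.1 hv).1).symm
          rw [this, Finset.card_singleton, Nat.cast_one]
          apply one_div_le_one_div_of_le (by positivity)
          gcongr
      _ ≤ _ := Finset.sum_le_sum_of_subset_of_nonneg hsub fun _ _ _ => by positivity
  refine (sum_hopStep_mul_le hG (pot_nonneg ..) {u} {p} (by positivity)
    (by rw [div_le_one (by positivity)]; linarith)
    (η := 1 / (((0 : ℕ) : ℝ) + 2)) (by positivity) hhit (fun c => pot_anti (le_hopNext G c))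
    fun c hc => ?_).trans ?_
  · obtain ⟨x, hx, hxS⟩ := hc
    rw [Finset.mem_singleton] at hx hxS
    subst hx
    refine pot_drop (le_hopNext G c) (potDen_of_linked (le_hopNext G c) hp ?_ ?_)
    · rw [closedNbr, Finset.mem_insert, not_or]
      exact hpu
    · exact Finset.mem_insert_of_mem (mem_nbr.2 (hopNext_adj G (Ne.symm hpu.1) hxS))
  · refine mul_le_mul_of_nonneg_right ?_ (pot_nonneg ..)
    have : (1 : ℝ) / (432 * n) ≤ 1 / (18 * n) / 2 * (1 / (((0 : ℕ) : ℝ) + 2)) := by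
      rw [div_div, div_mul_div_comm]
      apply div_le_div₀ <;> first | positivity | (push_cast; linarith)
    linarith

/-- The potential contracts in every round, as long as `P` leads from `u` to the target. -/
theorem pot_contract (hn : Fintype.card V = n) (hδ0 : 0 < δ) (hδ : ∀ x, δ ≤ deg G x)
    (hP : y ∉ closedNbr G u → ∃ v ∈ P, ∃ w ∈ P, v ∈ closedNbr G u ∧ w ∉ closedNbr G u ∧ G.Adj v w) :
    ∑ G', hopStep G G' * pot u δ P y G' ≤ (1 - 1 / (432 * n)) * pot u δ P y G := by
  by_cases hdone : y ∈ closedNbr G u ∨ 9 * δ ≤ 8 * deg G u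
  · rw [pot_of_done hdone, mul_zero]
    refine (Finset.sum_eq_zero fun G' _ => ?_).le
    by_cases h : hopStep G G' = 0
    · rw [h, zero_mul]
    · rw [pot_of_done (done_mono (le_of_hopStep_ne_zero h) hdone), mul_zero]
  rw [not_or, not_le] at hdone
  obtain ⟨hy, hd⟩ := hdone
  by_cases hE : δ ≤ 32 * (exceptional G u δ).card
  · exact pot_contract_of_exceptional hn hδ0 hδ hd hE
  rw [not_le] at hE
  have grow : ∀ p ∈ P, 1 ≤ tie G u δ p → 16 * tie G u δ p < δ →
      ∑ G', hopStep G G' * pot u δ P y G' ≤ (1 - 1 / (432 * n)) * pot u δ P y G := by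
    intro p hp h1 h2
    refine pot_contract_of_growth hn hδ0 hδ hp (M := nbr G p ∩ core G u δ)
      Finset.inter_subset_left ?_ fun v hv => ?_
    · change tie G u δ p + 2 ≤ 3 * tie G u δ p
      omega
    · have hv := (Finset.mem_filter.1 (Finset.mem_inter.1 hv).2).2
      have hsub : nbr G v ∩ closedNbr G u ⊆
          nbr G v ∩ ((closedNbr G u \ exceptional G u δ) \ insert p (nbr G p)) ∪
            (exceptional G u δ ∪ insert p (nbr G p ∩ core G u δ)) := by
        intro x hx
        simp only [exceptional, Finset.mem_inter, Finset.mem_union, Finset.mem_sdiff,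
          Finset.mem_insert, Finset.mem_filter] at hx ⊢
        tauto
      have c1 := Finset.card_le_card hsub
      have c2 := Finset.card_union_le
        (nbr G v ∩ ((closedNbr G u \ exceptional G u δ) \ insert p (nbr G p)))
        (exceptional G u δ ∪ insert p (nbr G p ∩ core G u δ))
      have c3 := Finset.card_union_le (exceptional G u δ) (insert p (nbr G p ∩ core G u δ))
      have c4 := Finset.card_insert_le p (nbr G p ∩ core G u δ)
      change _ ≤ tie G u δ p + 1 at c4
      omega
  obtain ⟨v, hvP, w, hwP, hv, hw, hvw⟩ := hP hy
  have hvu : v ∈ nbr G u := by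
    rcases Finset.mem_insert.1 hv with rfl | h
    · exact absurd (Finset.mem_insert_of_mem (mem_nbr.2 hvw)) hw
    · exact h
  have htv : 1 ≤ tie G u δ v := Finset.card_pos.2
    ⟨u, Finset.mem_inter.2 ⟨mem_nbr.2 (mem_nbr.1 hvu).symm, self_mem_core hδ⟩⟩
  by_cases h1 : 16 * tie G u δ v < δ
  · exact grow v hvP htv h1
  rw [not_lt] at h1
  by_cases h2 : 16 * tie G u δ w < δ
  · by_cases h3 : 1 ≤ tie G u δ w
    · exact grow w hwP h3 h2
    have h3 : tie G u δ w = 0 := by omega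
    refine pot_contract_of_growth hn hδ0 hδ hwP (M := {v})
      (Finset.singleton_subset_iff.2 (mem_nbr.2 hvw.symm)) ?_ fun v' hv' => ?_
    · rw [h3, Finset.card_singleton]
      norm_num
    · rw [Finset.mem_singleton] at hv'
      subst hv'
      have hcw : ∀ x ∈ core G u δ, x ∉ nbr G w := by
        intro x hx hxw
        have := Finset.card_eq_zero.1 h3
        exact Finset.notMem_empty x (this ▸ Finset.mem_inter.2 ⟨hxw, hx⟩)
      have hsub : nbr G v' ∩ core G u δ ⊆
          nbr G v' ∩ ((closedNbr G u \ exceptional G u δ) \ insert w (nbr G w)) ∪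
            exceptional G u δ := by
        intro x hx
        rw [Finset.mem_inter] at hx
        have hxc := (Finset.mem_filter.1 hx.2).1
        have hxw : x ≠ w := fun h => hw (h ▸ hxc)
        have := hcw x hx.2
        simp only [Finset.mem_inter, Finset.mem_union, Finset.mem_sdiff, Finset.mem_insert]
        tauto
      have c1 := Finset.card_le_card hsub
      have c2 := Finset.card_union_le
        (nbr G v' ∩ ((closedNbr G u \ exceptional G u δ) \ insert w (nbr G w)))
        (exceptional G u δ)
      change tie G u δ v' ≤ _ at c1
      omega
  · exact pot_contract_of_tie hn hδ0 hδ hd hwP hw (not_lt.1 h2)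

/-- A lower bound for the potential of a target that is not reached yet. -/
theorem le_pot (hn : Fintype.card V = n) (hP : P.card ≤ 5) (hy : y ∉ closedNbr G u)
    (hd : 8 * deg G u < 9 * δ) : 1 / (32 * (n : ℝ) ^ 6) ≤ pot u δ P y G := by
  have hd' := hn ▸ deg_le_card G u
  rw [pot, if_neg (by rw [not_or, not_le]; exact ⟨hy, hd⟩), ← one_div]
  have h1 : potDen G u δ P ≤ 32 * n ^ 6 := by
    have h2 : ∀ p ∈ P, tieFactor G u δ p ≤ 2 * n := by
      intro p _
      have h3 : tie G u δ p ≤ deg G p := Finset.card_le_card Finset.inter_subset_left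
      have h4 := hn ▸ deg_le_card G p
      unfold tieFactor
      split_ifs <;> omega
    calc potDen G u δ P ≤ n * (2 * n) ^ P.card :=
          Nat.mul_le_mul hd' (Finset.prod_le_pow_card _ _ _ h2)
      _ ≤ n * (2 * n) ^ 5 := by gcongr; omega
      _ = _ := by ring
  have h2 : (0 : ℝ) < potDen G u δ P := by exact_mod_cast potDen_pos G u δ P
  apply one_div_le_one_div_of_le h2
  exact_mod_cast h1

theorem pot_le_one : pot u δ P y G ≤ 1 := by
  unfold pot
  split_ifs
  · exact zero_le_one
  · exact inv_le_one_of_one_le₀ (by exact_mod_cast potDen_pos G u δ P)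

/-- If `u` is not joined to everything, then either its degree reaches `2 δ` or some vertex that
was within distance four of `u` is not linked to `u` yet. -/
theorem exists_not_linked {G0 : SimpleGraph V} (hG0 : G0.Connected) (hδ : ∀ x, δ ≤ deg G0 x)
    (h : G0 ≤ G) (hd : deg G u + 1 < Fintype.card V) (hd2 : deg G u < 2 * δ) :
    ∃ y, G0.dist u y ≤ 4 ∧ y ∉ closedNbr G u := by
  by_contra! hall
  obtain ⟨y, hy⟩ : ∃ y, y ∉ closedNbr G u := by
    by_contra! hy
    have h1 := Finset.card_insert_le u (nbr G u)
    have h2 : closedNbr G u = Finset.univ := Finset.eq_univ_iff_forall.2 hy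
    change (closedNbr G u).card ≤ deg G u + 1 at h1
    rw [h2, Finset.card_univ] at h1
    omega
  obtain ⟨q, hq⟩ := hG0.exists_walk_length_eq_dist u y
  have hlen : 5 ≤ G0.dist u y := by
    by_contra hlt
    exact hy (hall y (by omega))
  set z := q.getVert 3 with hz
  have hz1 : G0.dist u z ≤ 3 := by
    refine (SimpleGraph.dist_le (q.take 3)).trans ?_
    rw [SimpleGraph.Walk.take_length]
    omega
  have hz2 : G0.dist z y ≤ q.length - 3 := by
    refine (SimpleGraph.dist_le (q.drop 3)).trans ?_
    rw [SimpleGraph.Walk.drop_length]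
  have hz3 := hG0.dist_triangle (u := u) (v := z) (w := y)
  have hfar : ∀ x ∈ nbr G0 z, 2 ≤ G0.dist u x ∧ G0.dist u x ≤ 4 := by
    intro x hx
    have h1 : G0.dist z x = 1 := SimpleGraph.dist_eq_one_iff_adj.2 (mem_nbr.1 hx)
    have h2 := hG0.dist_triangle (u := u) (v := z) (w := x)
    have h3 := hG0.dist_triangle (u := u) (v := x) (w := z)
    have h4 : G0.dist x z = 1 := by rw [SimpleGraph.dist_comm, h1]
    omega
  have hdisj : Disjoint (nbr G0 u) (nbr G0 z) := by
    rw [Finset.disjoint_left]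
    intro x hx hxz
    have h1 : G0.dist u x = 1 := SimpleGraph.dist_eq_one_iff_adj.2 (mem_nbr.1 hx)
    have := (hfar x hxz).1
    omega
  have hsub : nbr G0 u ∪ nbr G0 z ⊆ nbr G u := by
    refine Finset.union_subset (nbr_mono h u) fun x hx => ?_
    obtain ⟨h1, h2⟩ := hfar x hx
    rcases Finset.mem_insert.1 (hall x h2) with rfl | h3
    · rw [SimpleGraph.dist_self] at h1
      omega
    · exact h3
  have hcard := Finset.card_le_card hsub
  rw [Finset.card_union_of_disjoint hdisj] at hcard
  have h1 := hδ u
  have h2 := hδ z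
  unfold deg at *
  omega

end

/-- There is a constant `C > 0` such that for every `n ≥ 2`, every
connected initial graph `G₀` on `n` vertices with minimum degree `δ₀`, and every vertex
`u`, with `T = ⌈C·n·ln n⌉`: the probability, over the trajectory of the two-hop walk
process started at `G₀`, that both `|N_T²(u)| ≥ δ₀/4` and
`d_T(u) < min {(1 + 1/8)·δ₀, n − 1}`, is at most `1/n²`. -/
theorem twoHop_large_second_neighborhood :
    ∃ C : ℝ, 0 < C ∧
      ∀ (V : Type) [Fintype V] [DecidableEq V] (n : ℕ), 2 ≤ n → Fintype.card V = n →
        ∀ (G0 : SimpleGraph V), G0.Connected → ∀ u : V,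
          ∀ T : ℕ, T = ⌈C * n * Real.log n⌉₊ →
            trajProb hopStep G0 T (fun g =>
              (minDeg G0 : ℝ) / 4 ≤ ((Nk (g T) u 2).card : ℝ)
              ∧ (deg (g T) u : ℝ) < min ((1 + 1/8) * (minDeg G0 : ℝ)) ((n : ℝ) - 1))
            ≤ 1 / (n : ℝ) ^ 2 := by
  refine ⟨6480, by norm_num, ?_⟩
  intro V _ _ n hn hcard G0 hG0 u T hT
  set δ := minDeg G0 with hδdef
  have hδ : ∀ x, δ ≤ deg G0 x := fun x => Nat.sInf_le ⟨x, rfl⟩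
  have hn0 : (0 : ℝ) < n := by positivity
  have hδ0 : 0 < δ := by
    have : Nontrivial V := Fintype.one_lt_card_iff_nontrivial.1 (by omega)
    obtain ⟨x, hx⟩ : δ ∈ Set.range (deg G0) := Nat.sInf_mem ⟨_, ⟨u, rfl⟩⟩
    obtain ⟨v, hv⟩ := hG0.preconnected.exists_adj_of_nontrivial x
    exact hx ▸ Finset.card_pos.2 ⟨v, mem_nbr.2 hv⟩
  choose q hq using fun y => hG0.exists_walk_length_eq_dist u y
  set F : Finset V := Finset.univ.filter fun y => G0.dist u y ≤ 4 with hF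
  set Ψ : SimpleGraph V → ℝ := fun G =>
    32 * (n : ℝ) ^ 6 * ∑ y ∈ F, pot u δ (q y).support.toFinset y G with hΨdef
  have hΨ0 : ∀ G, 0 ≤ Ψ G := fun G =>
    mul_nonneg (by positivity) (Finset.sum_nonneg fun y _ => pot_nonneg ..)
  have hcontr : ∀ G ∈ Set.Ici G0,
      ∑ G', hopStep G G' * Ψ G' ≤ (1 - 1 / (432 * n)) * Ψ G := by
    intro G hG
    have hpot : ∀ y ∈ F, ∑ G', hopStep G G' * pot u δ (q y).support.toFinset y G' ≤
        (1 - 1 / (432 * n)) * pot u δ (q y).support.toFinset y G := by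
      intro y _
      refine pot_contract hcard hδ0 (fun x => (hδ x).trans (deg_mono hG x)) fun hy => ?_
      obtain ⟨d, hd, h1, h2⟩ := (q y).exists_boundary_dart {x | x ∈ closedNbr G u}
        (Finset.mem_insert_self _ _) hy
      exact ⟨d.fst, List.mem_toFinset.2 ((q y).dart_fst_mem_support_of_mem_darts hd), d.snd,
        List.mem_toFinset.2 ((q y).dart_snd_mem_support_of_mem_darts hd), h1, h2, hG d.adj⟩
    calc ∑ G', hopStep G G' * Ψ G'
        = 32 * (n : ℝ) ^ 6 *
            ∑ y ∈ F, ∑ G', hopStep G G' * pot u δ (q y).support.toFinset y G' := by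
          rw [Finset.sum_comm, Finset.mul_sum]
          refine Finset.sum_congr rfl fun G' _ => ?_
          rw [← Finset.mul_sum]
          ring
      _ ≤ 32 * (n : ℝ) ^ 6 *
            ∑ y ∈ F, (1 - 1 / (432 * n)) * pot u δ (q y).support.toFinset y G := by
          gcongr with y hy
          exact hpot y hy
      _ = _ := by
          rw [← Finset.mul_sum]
          ring
  have hρ : (0 : ℝ) ≤ 1 - 1 / (432 * n) := by
    have : (2 : ℝ) ≤ n := by exact_mod_cast hn
    rw [sub_nonneg, div_le_one (by positivity)]
    linarith
  have hevent : ∀ G ∈ Set.Ici G0, ((δ : ℝ) / 4 ≤ ((Nk G u 2).card : ℝ) ∧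
      (deg G u : ℝ) < min ((1 + 1/8) * (δ : ℝ)) ((n : ℝ) - 1)) → 1 ≤ Ψ G := by
    rintro G hG ⟨-, hd⟩
    rw [lt_min_iff] at hd
    have hd1 : 8 * deg G u < 9 * δ := by
      have : (8 : ℝ) * deg G u < 9 * δ := by linarith [hd.1]
      exact_mod_cast this
    have hd2 : deg G u + 1 < Fintype.card V := by
      have : (deg G u : ℝ) + 1 < n := by linarith [hd.2]
      rw [hcard]
      exact_mod_cast this
    obtain ⟨y, hy4, hy⟩ := exists_not_linked hG0 hδ hG hd2 (by omega)
    have hlen : (q y).support.toFinset.card ≤ 5 := by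
      refine (List.toFinset_card_le _).trans ?_
      rw [SimpleGraph.Walk.length_support, hq]
      omega
    have h1 := le_pot (P := (q y).support.toFinset) hcard hlen hy hd1
    have h2 := Finset.single_le_sum (f := fun y => pot u δ (q y).support.toFinset y G)
      (fun y _ => pot_nonneg ..) (Finset.mem_filter.2 ⟨Finset.mem_univ y, hy4⟩ : y ∈ F)
    have h3 := h1.trans h2
    rw [div_le_iff₀ (by positivity)] at h3
    rw [hΨdef]
    linarith
  have hΨ1 : Ψ G0 ≤ 32 * (n : ℝ) ^ 7 := by
    have : ∑ y ∈ F, pot u δ (q y).support.toFinset y G0 ≤ n := by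
      refine (Finset.sum_le_card_nsmul F _ 1 fun y _ => pot_le_one).trans ?_
      rw [nsmul_eq_mul, mul_one, ← hcard]
      exact_mod_cast Finset.card_le_univ F
    calc Ψ G0 ≤ 32 * (n : ℝ) ^ 6 * n := mul_le_mul_of_nonneg_left this (by positivity)
      _ = _ := by ring
  have hdecay : (1 - 1 / (432 * (n : ℝ))) ^ T ≤ 1 / (n : ℝ) ^ 15 := by
    have hTle : 6480 * n * Real.log n ≤ T := hT ▸ Nat.le_ceil _
    calc (1 - 1 / (432 * (n : ℝ))) ^ T ≤ Real.exp (-(1 / (432 * (n : ℝ)))) ^ T := by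
          gcongr
          exact Real.one_sub_le_exp_neg _
      _ = Real.exp (-(T / (432 * (n : ℝ)))) := by
          rw [← Real.exp_nat_mul]
          congr 1
          ring
      _ ≤ Real.exp (-(15 * Real.log n)) := by
          rw [Real.exp_le_exp, neg_le_neg_iff, le_div_iff₀ (by positivity)]
          linarith
      _ = 1 / (n : ℝ) ^ 15 := by
          have : Real.exp (15 * Real.log n) = (n : ℝ) ^ 15 := by
            have := Real.exp_nat_mul (Real.log n) 15
            rw [Real.exp_log hn0] at this
            exact_mod_cast this
          rw [Real.exp_neg, this, one_div]
  have h32 : (32 : ℝ) ≤ (n : ℝ) ^ 5 := by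
    have : 2 ^ 5 ≤ n ^ 5 := Nat.pow_le_pow_left hn 5
    exact_mod_cast this
  calc _ ≤ (1 - 1 / (432 * (n : ℝ))) ^ T * Ψ G0 :=
        trajProb_le_of_contracting hopStep_nonneg (Set.Ici G0)
          (fun G hG G' h => le_trans hG (le_of_hopStep_ne_zero h)) hΨ0 hρ hcontr hevent T G0
          (Set.mem_Ici.2 le_rfl)
    _ ≤ 1 / (n : ℝ) ^ 15 * ((n : ℝ) ^ 5 * (n : ℝ) ^ 7) := by
        refine mul_le_mul hdecay (hΨ1.trans ?_) (hΨ0 G0) (by positivity)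
        gcongr
    _ ≤ 1 / (n : ℝ) ^ 2 := by
        have hn1 : (1 : ℝ) ≤ n := by exact_mod_cast (by omega : 1 ≤ n)
        rw [one_div_mul_eq_div, div_le_div_iff₀ (by positivity) (by positivity), ← pow_add,
          ← pow_add, one_mul]
        exact pow_le_pow_right₀ hn1 (by norm_num)
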